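/- Let d ≥ 1, let Δ be a simplicial complex on the vertex set [d] = {1,...,d}, and let P_Δ ⊂ ℝ^d be the convex hull of the indicator vectors of the faces of Δ. Then the following conditions are equivalent: (i) Γ(O_P, P_Δ) is a reflexive polytope for some finite partially ordered set P on [d]; (ii) Γ(O_P, P_Δ) is a reflexive polytope for all finite partially ordered sets P on [d]; (iii) there exists a perfect graph G on [d] such that P_Δ equals the stable set polytope Q_G of G. -/

import Mathlib

open scoped Pointwise

namespace HibiTsuchiya

/-- A point of `ℝ^n` is a *lattice point* if all of its coordinates are integers. -/
def IsLatticePoint {n : ℕ} (x : Fin n → ℝ) : Prop := ∀ i, ∃ z : ℤ, x i = (z : ℝ)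

/-- The dual polytope `P^∨ = {x : ⟨x,y⟩ ≤ 1 for all y ∈ P}`. -/
def dualPolytope {n : ℕ} (P : Set (Fin n → ℝ)) : Set (Fin n → ℝ) :=
  {x | ∀ y ∈ P, ∑ i, x i * y i ≤ 1}

/-- A polytope `P ⊆ ℝ^n` is *reflexive* if the origin is an interior point of `P` and the
dual polytope of `P` is again a lattice polytope (i.e. the convex hull of finitely many
lattice points). -/
def IsReflexive {n : ℕ} (P : Set (Fin n → ℝ)) : Prop :=
  0 ∈ interior P ∧
    ∃ V : Finset (Fin n → ℝ), (∀ v ∈ V, IsLatticePoint v) ∧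
      dualPolytope P = convexHull ℝ (V : Set (Fin n → ℝ))

/-- `P` has the *integer decomposition property* if every lattice point of `m • P` (`m ≥ 1`)
is a sum of `m` lattice points of `P`. -/
def HasIDP {n : ℕ} (P : Set (Fin n → ℝ)) : Prop :=
  ∀ m : ℕ, 0 < m → ∀ a : Fin n → ℝ, IsLatticePoint a → a ∈ (m : ℝ) • P →
    ∃ f : Fin m → Fin n → ℝ, (∀ k, f k ∈ P ∧ IsLatticePoint (f k)) ∧ a = ∑ k, f k

/-- The indicator vector `ρ(S) = ∑_{j ∈ S} e_j` of a subset `S ⊆ [n]`. -/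
noncomputable def indicator {n : ℕ} (S : Set (Fin n)) : Fin n → ℝ :=
  S.indicator (fun _ => (1 : ℝ))

/-- A poset ideal of a partial order `P` on `[n]`. -/
def IsPosetIdeal {n : ℕ} (P : PartialOrder (Fin n)) (I : Set (Fin n)) : Prop :=
  ∀ i ∈ I, ∀ j, P.le j i → j ∈ I

/-- The order polytope `O_P`: the convex hull of the indicator vectors of poset ideals. -/
noncomputable def orderPolytope {n : ℕ} (P : PartialOrder (Fin n)) : Set (Fin n → ℝ) :=
  convexHull ℝ {x | ∃ I : Set (Fin n), IsPosetIdeal P I ∧ x = indicator I}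

/-- An antichain of a partial order `P` on `[n]`: a pairwise incomparable subset. -/
def IsPosetAntichain {n : ℕ} (P : PartialOrder (Fin n)) (A : Set (Fin n)) : Prop :=
  ∀ i ∈ A, ∀ j ∈ A, i ≠ j → ¬ P.le i j ∧ ¬ P.le j i

/-- The chain polytope `C_P`: the convex hull of the indicator vectors of antichains. -/
noncomputable def chainPolytope {n : ℕ} (P : PartialOrder (Fin n)) : Set (Fin n → ℝ) :=
  convexHull ℝ {x | ∃ A : Set (Fin n), IsPosetAntichain P A ∧ x = indicator A}

/-- A stable (independent) set of a graph. -/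
def IsStableSet {V : Type*} (G : SimpleGraph V) (S : Set V) : Prop :=
  ∀ i ∈ S, ∀ j ∈ S, ¬ G.Adj i j

/-- The stable set polytope `Q_G`: the convex hull of the indicator vectors of stable sets. -/
noncomputable def stableSetPolytope {n : ℕ} (G : SimpleGraph (Fin n)) : Set (Fin n → ℝ) :=
  convexHull ℝ {x | ∃ S : Set (Fin n), IsStableSet G S ∧ x = indicator S}

/-- The clique number of a graph, as an extended natural number. -/
noncomputable def cliqueNumber {V : Type*} (G : SimpleGraph V) : ℕ∞ :=
  ⨆ (t : Finset V) (_ : G.IsClique (t : Set V)), (t.card : ℕ∞)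

/-- A graph is *perfect* if for every induced subgraph (including the graph itself)
the chromatic number equals the clique number. -/
def IsPerfectGraph {V : Type*} (G : SimpleGraph V) : Prop :=
  ∀ s : Set V, (G.induce s).chromaticNumber = cliqueNumber (G.induce s)

/-- A simplicial complex on the vertex set `[n]`. -/
def IsSimplicialComplex {n : ℕ} (Δ : Set (Finset (Fin n))) : Prop :=
  (∀ i : Fin n, {i} ∈ Δ) ∧ ∀ F ∈ Δ, ∀ F' ⊆ F, F' ∈ Δ

/-- The polytope `P_Δ`: the convex hull of the indicator vectors of the faces of `Δ`. -/
noncomputable def complexPolytope {n : ℕ} (Δ : Set (Finset (Fin n))) : Set (Fin n → ℝ) :=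
  convexHull ℝ {x | ∃ F ∈ Δ, x = indicator (↑F : Set (Fin n))}

/-- `Γ(P,Q) = conv(P ∪ (−Q))`. -/
noncomputable def gammaPolytope {n : ℕ} (P Q : Set (Fin n → ℝ)) : Set (Fin n → ℝ) :=
  convexHull ℝ (P ∪ -Q)

/-- `Ω(P,Q) = conv((P × {1}) ∪ ((−Q) × {−1})) ⊆ ℝ^{n+1}`. -/
noncomputable def omegaPolytope {n : ℕ} (P Q : Set (Fin n → ℝ)) : Set (Fin (n+1) → ℝ) :=
  convexHull ℝ
    ((fun x : Fin n → ℝ => Fin.snoc x (1 : ℝ)) '' P ∪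
     (fun x : Fin n → ℝ => Fin.snoc x (-1 : ℝ)) '' (-Q))

open Finset in
/-- weighted colouring of perfect graphs (replication lemma) -/
theorem weighted_cover {d : ℕ} (G : SimpleGraph (Fin d)) (hG : IsPerfectGraph G) :
    ∀ (m : ℕ) (z : Fin d → ℕ) (N : ℕ), (∑ i, z i ≤ m) →
      (∀ K : Finset (Fin d), G.IsClique (K : Set (Fin d)) → ∑ i ∈ K, z i ≤ N) →
      ∃ f : Fin N → Finset (Fin d), (∀ k, IsStableSet G (f k : Set (Fin d))) ∧
        ∀ i, z i ≤ ∑ k, if i ∈ f k then 1 else 0 := by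
  classical
  intro m
  induction m with
  | zero =>
    intro z N hz _
    have h0 : ∀ i, z i = 0 := by simpa using hz
    exact ⟨fun _ => ∅, fun k => by intro i hi; simp at hi, fun i => by simp [h0]⟩
  | succ m ih =>
    intro z N hz hK
    by_cases hx : ∃ x, 2 ≤ z x
    · obtain ⟨x, hx⟩ := hx
      obtain ⟨f, hf, hcov⟩ := ih (fun i => if i = x then z i - 1 else z i) N (by
        have : ∑ i, (if i = x then z i - 1 else z i) < ∑ i, z i := by
          apply Finset.sum_lt_sum
          · intro i _; split_ifs <;> omega
          · exact ⟨x, mem_univ _, by simp; omega⟩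
        omega) (by
        intro K hKc
        refine le_trans (Finset.sum_le_sum ?_) (hK K hKc)
        intro i _; split_ifs <;> omega)
      obtain ⟨k0, hk0⟩ : ∃ k, x ∈ f k := by
        by_contra hcon
        push Not at hcon
        have := hcov x
        simp [hcon] at this
        omega
      obtain ⟨M, rfl⟩ : ∃ M, N = M + 1 := ⟨N - 1, by have := k0.pos; omega⟩
      obtain ⟨g, hg, hgcov⟩ := ih (fun i => if i ∈ f k0 then z i - 1 else z i) M (by
        have : ∑ i, (if i ∈ f k0 then z i - 1 else z i) < ∑ i, z i := by
          apply Finset.sum_lt_sum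
          · intro i _; split_ifs <;> omega
          · exact ⟨x, mem_univ _, by simp [hk0]; omega⟩
        omega) (by
        intro K hKc
        by_contra hlt
        push Not at hlt
        set K' := K.filter (fun i => z i ≠ 0) with hK'
        have hK'c : G.IsClique (K' : Set (Fin d)) := hKc.subset (Finset.coe_subset.2 (Finset.filter_subset _ _))
        have e1 : ∑ i ∈ K, (if i ∈ f k0 then z i - 1 else z i)
            = ∑ i ∈ K', (if i ∈ f k0 then z i - 1 else z i) := by
          rw [hK']
          symm
          apply Finset.sum_filter_of_ne
          intro i _ hne h0
          apply hne; simp [h0]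
        have hdisj : ∀ i ∈ K', i ∉ f k0 := by
          intro i hi hif
          have : ∑ i ∈ K', (if i ∈ f k0 then z i - 1 else z i) < ∑ i ∈ K', z i := by
            apply Finset.sum_lt_sum
            · intro i _; split_ifs <;> omega
            · have h1 := (Finset.mem_filter.1 hi).2
              exact ⟨i, hi, by simp [hif]; omega⟩
          have := hK K' hK'c
          omega
        have hxK : x ∉ K' := fun h => hdisj x h hk0
        have e2 : ∑ i ∈ K', (if i ∈ f k0 then z i - 1 else z i) = ∑ i ∈ K', z i :=
          Finset.sum_congr rfl fun i hi => by simp [hdisj i hi]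
        have e3 : ∑ i ∈ K', z i ≤ ∑ i ∈ K', ∑ k, if i ∈ f k then 1 else 0 := by
          apply Finset.sum_le_sum
          intro i hi
          have := hcov i
          have hne : i ≠ x := fun h => hxK (h ▸ hi)
          simpa only [hne, if_false] using this
        rw [Finset.sum_comm] at e3
        have e4 : ∑ k, ∑ i ∈ K', (if i ∈ f k then 1 else 0) < ∑ k : Fin (M+1), 1 := by
          apply Finset.sum_lt_sum
          · intro k _
            rw [← Finset.sum_filter, ← Finset.card_eq_sum_ones, Finset.card_le_one]
            intro a ha b hb
            by_contra hab
            simp only [Finset.mem_filter] at ha hb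
            exact hf k a ha.2 b hb.2 (hK'c ha.1 hb.1 hab)
          · refine ⟨k0, mem_univ _, ?_⟩
            rw [Finset.sum_eq_zero]
            · norm_num
            · intro i hi; simp [hdisj i hi]
        simp at e4
        simp at e3
        omega)
      refine ⟨Fin.cons (f k0) g, ?_, ?_⟩
      · intro k
        refine Fin.cases ?_ ?_ k
        · simpa using hf k0
        · intro k; simpa using hg k
      · intro i
        have := hgcov i
        rw [Fin.sum_univ_succ]
        simp only [Fin.cons_zero, Fin.cons_succ]
        split_ifs at this ⊢ <;> omega
    · push Not at hx
      have hcol : (G.induce {i | z i ≠ 0}).Colorable N := by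
        rw [← SimpleGraph.chromaticNumber_le_iff_colorable, hG]
        unfold cliqueNumber
        refine iSup₂_le fun t ht => ?_
        have h1 := hK (t.map (Function.Embedding.subtype _)) (by
          intro a ha b hb hab
          simp only [coe_map, Function.Embedding.subtype_apply, Set.mem_image] at ha hb
          obtain ⟨a, ha, rfl⟩ := ha
          obtain ⟨b, hb, rfl⟩ := hb
          exact ht ha hb (fun h => hab (by rw [h])))
        rw [Finset.sum_map] at h1
        have h2 : t.card ≤ ∑ i ∈ t, z i.1 := by
          rw [Finset.card_eq_sum_ones]
          exact Finset.sum_le_sum fun i _ => Nat.one_le_iff_ne_zero.2 i.2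
        exact_mod_cast h2.trans h1
      obtain ⟨c⟩ := hcol
      refine ⟨fun k => univ.filter (fun i => ∃ h : z i ≠ 0, c ⟨i, h⟩ = k), ?_, ?_⟩
      · intro k i hi j hj hadj
        simp only [coe_filter, mem_univ, true_and, Set.mem_ofPred_eq] at hi hj
        obtain ⟨hi, hi'⟩ := hi
        obtain ⟨hj, hj'⟩ := hj
        exact c.valid (v := ⟨i, hi⟩) (w := ⟨j, hj⟩) (by simpa using hadj) (hi'.trans hj'.symm)
      · intro i
        by_cases h : z i = 0
        · simp [h]
        · have := hx i
          calc z i ≤ 1 := by omega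
            _ = (if i ∈ univ.filter (fun i => ∃ h : z i ≠ 0, c ⟨i, h⟩ = c ⟨i, h⟩) then 1 else 0) := by
                simp [h]
            _ ≤ _ := by
                refine le_trans ?_ (Finset.single_le_sum (fun _ _ => Nat.zero_le _) (mem_univ (c ⟨i, h⟩)))
                simp [h]

theorem separation {d : ℕ} (C : Set (Fin d → ℝ)) (hC : Convex ℝ C) (hcl : IsClosed C)
    (w : Fin d → ℝ) (hw : w ∉ C) :
    ∃ (z : Fin d → ℝ) (u : ℝ), (∀ a ∈ C, ∑ i, z i * a i < u) ∧ u < ∑ i, z i * w i := by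
  obtain ⟨f, u, h1, h2⟩ := geometric_hahn_banach_closed_point hC hcl hw
  have key : ∀ x, f x = ∑ i, f (Pi.single i 1) * x i := by
    intro x
    have := LinearMap.pi_apply_eq_sum_univ (f : (Fin d → ℝ) →ₗ[ℝ] ℝ) x
    simp only [ContinuousLinearMap.coe_coe, smul_eq_mul] at this
    rw [this]
    refine Finset.sum_congr rfl fun i _ => ?_
    rw [mul_comm]
    congr 2
    ext j
    simp [Pi.single_apply, eq_comm]
  refine ⟨fun i => f (Pi.single i 1), u, fun a ha => ?_, ?_⟩
  · rw [← key]; exact h1 a ha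
  · rw [← key]; exact h2

theorem sum_mul_indicator {d : ℕ} (z : Fin d → ℝ) (F : Finset (Fin d)) :
    ∑ i, z i * indicator (F : Set (Fin d)) i = ∑ i ∈ F, z i := by
  classical
  simp [indicator, Set.indicator_apply, Finset.sum_ite_mem]

theorem complex_closed {d : ℕ} (Δ : Set (Finset (Fin d))) : IsClosed (complexPolytope Δ) := by
  apply Set.Finite.isClosed_convexHull
  have : {x : Fin d → ℝ | ∃ F ∈ Δ, x = indicator (↑F : Set (Fin d))}
      = (fun F : Finset (Fin d) => indicator (↑F : Set (Fin d))) '' Δ := by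
    ext x; simp [eq_comm]
  rw [this]
  exact Set.Finite.image _ (Set.toFinite _)

theorem complex_mem {d : ℕ} (Δ : Set (Finset (Fin d))) (F : Finset (Fin d)) (hF : F ∈ Δ) :
    indicator (↑F : Set (Fin d)) ∈ complexPolytope Δ :=
  subset_convexHull ℝ _ ⟨F, hF, rfl⟩

theorem complex_decomp {d : ℕ} (Δ : Set (Finset (Fin d))) (x : Fin d → ℝ)
    (hx : x ∈ complexPolytope Δ) :
    ∃ y : Finset (Fin d) → ℝ, (∀ F, 0 ≤ y F) ∧ ∑ F, y F = 1 ∧ (∀ F, y F ≠ 0 → F ∈ Δ) ∧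
      ∀ i, x i = ∑ F, if i ∈ F then y F else 0 := by
  classical
  let C : Set (Fin d → ℝ) := {x | ∃ y : Finset (Fin d) → ℝ, (∀ F, 0 ≤ y F) ∧ ∑ F, y F = 1 ∧
    (∀ F, y F ≠ 0 → F ∈ Δ) ∧ ∀ i, x i = ∑ F, if i ∈ F then y F else 0}
  have hsub : complexPolytope Δ ⊆ C := by
    apply convexHull_min
    · rintro _ ⟨F, hF, rfl⟩
      refine ⟨fun F' => if F' = F then 1 else 0, fun F' => by dsimp only; split_ifs <;> norm_num, by simp, ?_, ?_⟩
      · intro F' h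
        by_cases h' : F' = F
        · rwa [h']
        · simp [h'] at h
      · intro i
        rw [Finset.sum_eq_single F]
        · simp [indicator, Set.indicator_apply]
        · intro b _ hb; simp [hb]
        · simp
    · rintro x ⟨y, h1, h2, h3, h4⟩ x' ⟨y', h1', h2', h3', h4'⟩ a b ha hb hab
      refine ⟨fun F => a * y F + b * y' F, fun F => add_nonneg (mul_nonneg ha (h1 F)) (mul_nonneg hb (h1' F)), ?_, ?_, ?_⟩
      · rw [Finset.sum_add_distrib, ← Finset.mul_sum, ← Finset.mul_sum, h2, h2']; linarith
      · intro F hF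
        by_cases h : y F = 0
        · apply h3'
          intro h'; simp [h, h'] at hF
        · exact h3 F h
      · intro i
        simp only [Pi.add_apply, Pi.smul_apply, smul_eq_mul, h4, h4', Finset.mul_sum, ← Finset.sum_add_distrib]
        refine Finset.sum_congr rfl fun F _ => ?_
        split_ifs <;> simp
  exact hsub hx

theorem perfect_decomp {d : ℕ} (G : SimpleGraph (Fin d)) (hG : IsPerfectGraph G)
    (w : Fin d → ℝ) (hw0 : ∀ i, 0 ≤ w i)
    (hw : ∀ S : Finset (Fin d), IsStableSet G (S : Set (Fin d)) → ∑ i ∈ S, w i ≤ 1) :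
    w ∈ complexPolytope {K : Finset (Fin d) | G.IsClique (K : Set (Fin d))} := by
  classical
  by_contra hcon
  obtain ⟨z, u, h1, h2⟩ := separation _ (convex_convexHull ℝ _) (complex_closed _) w hcon
  have hK : ∀ K : Finset (Fin d), G.IsClique (K : Set (Fin d)) → ∑ i ∈ K, max (z i) 0 ≤ u := by
    intro K hKc
    have h3 := h1 _ (complex_mem _ (K.filter (fun i => 0 < z i))
      (hKc.subset (Finset.coe_subset.2 (Finset.filter_subset _ _)) : G.IsClique ((K.filter (fun i => 0 < z i) : Finset (Fin d)) : Set (Fin d))))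
    rw [sum_mul_indicator, Finset.sum_filter] at h3
    refine le_trans (le_of_eq (Finset.sum_congr rfl fun i _ => ?_)) h3.le
    split_ifs with h
    · exact max_eq_left h.le
    · exact max_eq_right (not_lt.1 h)
  have hzw : ∑ i, z i * w i ≤ ∑ i, max (z i) 0 * w i :=
    Finset.sum_le_sum fun i _ => mul_le_mul_of_nonneg_right (le_max_left _ _) (hw0 i)
  have hu : 0 ≤ u := by simpa using hK ∅ (by simp)
  have main : ∀ m : ℕ, (m : ℝ) * ∑ i, max (z i) 0 * w i ≤ m * u + d := by
    intro m
    set q : Fin d → ℕ := fun i => ⌈(m : ℝ) * max (z i) 0⌉₊ with hq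
    have hq1 : ∀ i, (m : ℝ) * max (z i) 0 ≤ q i := fun i => Nat.le_ceil _
    have hq2 : ∀ i, (q i : ℝ) ≤ m * max (z i) 0 + 1 := fun i =>
      (Nat.ceil_lt_add_one (by positivity)).le
    obtain ⟨f, hf, hcov⟩ := weighted_cover G hG _ q ⌊(m : ℝ) * u + d⌋₊ le_rfl (by
      intro K hKc
      apply Nat.le_floor
      push_cast
      calc ∑ i ∈ K, (q i : ℝ) ≤ ∑ i ∈ K, ((m : ℝ) * max (z i) 0 + 1) :=
            Finset.sum_le_sum fun i _ => hq2 i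
        _ = m * ∑ i ∈ K, max (z i) 0 + K.card := by
            rw [Finset.sum_add_distrib, Finset.mul_sum]; simp
        _ ≤ m * u + d := by
            have : (K.card : ℝ) ≤ d := by
              have := Finset.card_le_univ K
              simp at this
              exact_mod_cast this
            have := mul_le_mul_of_nonneg_left (hK K hKc) (Nat.cast_nonneg (α := ℝ) m)
            linarith)
    calc (m : ℝ) * ∑ i, max (z i) 0 * w i = ∑ i, ((m : ℝ) * max (z i) 0) * w i := by
          rw [Finset.mul_sum]; exact Finset.sum_congr rfl fun i _ => by ring
      _ ≤ ∑ i, (∑ k, if i ∈ f k then (1 : ℝ) else 0) * w i := by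
          refine Finset.sum_le_sum fun i _ => mul_le_mul_of_nonneg_right ?_ (hw0 i)
          refine (hq1 i).trans ?_
          have := hcov i
          have h' : (q i : ℝ) ≤ ((∑ k, if i ∈ f k then 1 else 0 : ℕ) : ℝ) := by exact_mod_cast this
          simpa using h'
      _ = ∑ k, ∑ i ∈ f k, w i := by
          simp_rw [Finset.sum_mul]
          rw [Finset.sum_comm]
          refine Finset.sum_congr rfl fun k _ => ?_
          simp [Finset.sum_ite_mem]
      _ ≤ ∑ k : Fin ⌊(m : ℝ) * u + d⌋₊, (1 : ℝ) := Finset.sum_le_sum fun k _ => hw _ (hf k)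
      _ ≤ m * u + d := by
          simp only [Finset.sum_const, Finset.card_univ, Fintype.card_fin, nsmul_eq_mul, mul_one]
          exact Nat.floor_le (by positivity)
  have hgap : 0 < ∑ i, max (z i) 0 * w i - u := by linarith
  obtain ⟨m, hm⟩ := exists_nat_gt ((d : ℝ) / (∑ i, max (z i) 0 * w i - u))
  rw [div_lt_iff₀ hgap] at hm
  have := main m
  nlinarith

/-- The system of inequalities describing the dual polytope. -/
def Dset {d : ℕ} (A B : Set (Finset (Fin d))) : Set (Fin d → ℝ) :=
  {x | (∀ I ∈ A, ∑ i ∈ I, x i ≤ 1) ∧ ∀ S ∈ B, -1 ≤ ∑ i ∈ S, x i}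

theorem dual_hull {d : ℕ} (X : Set (Fin d → ℝ)) (x : Fin d → ℝ) :
    x ∈ dualPolytope (convexHull ℝ X) ↔ ∀ y ∈ X, ∑ i, x i * y i ≤ 1 := by
  constructor
  · intro h y hy
    exact h y (subset_convexHull ℝ _ hy)
  · intro h y hy
    have hc : Convex ℝ {y : Fin d → ℝ | ∑ i, x i * y i ≤ 1} := by
      apply convex_halfSpace_le
      constructor
      · intro u v; simp [mul_add, Finset.sum_add_distrib]
      · intro c u
        simp only [Pi.smul_apply, smul_eq_mul, Finset.mul_sum]
        exact Finset.sum_congr rfl fun i _ => by ring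
    exact convexHull_min (s := X) h hc hy

theorem set_eq_coe {d : ℕ} (S : Set (Fin d)) : ∃ F : Finset (Fin d), (F : Set (Fin d)) = S :=
  ⟨(Set.toFinite S).toFinset, by simp⟩

theorem dual_gamma {d : ℕ} (P : PartialOrder (Fin d)) (Δ : Set (Finset (Fin d))) :
    dualPolytope (gammaPolytope (orderPolytope P) (complexPolytope Δ)) =
      Dset {I | IsPosetIdeal P (I : Set (Fin d))} Δ := by
  ext x
  rw [gammaPolytope, dual_hull]
  constructor
  · intro h
    constructor
    · intro I hI
      have := h (indicator (I : Set (Fin d))) (Or.inl (subset_convexHull ℝ _ ⟨I, hI, rfl⟩))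
      rwa [sum_mul_indicator] at this
    · intro S hS
      have := h (-indicator (S : Set (Fin d))) (Or.inr (by
        rw [Set.neg_mem_neg]; exact complex_mem _ _ hS))
      simp only [Pi.neg_apply, mul_neg, Finset.sum_neg_distrib] at this
      rw [sum_mul_indicator] at this
      linarith
  · rintro ⟨h1, h2⟩ y (hy | hy)
    · refine (dual_hull _ x).2 ?_ y hy
      rintro _ ⟨I, hI, rfl⟩
      obtain ⟨F, rfl⟩ := set_eq_coe I
      rw [sum_mul_indicator]
      exact h1 F hI
    · have : -x ∈ dualPolytope (complexPolytope Δ) := by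
        refine (dual_hull _ _).2 ?_
        rintro _ ⟨S, hS, rfl⟩
        rw [sum_mul_indicator]
        have := h2 S hS
        simp only [Pi.neg_apply, Finset.sum_neg_distrib]
        linarith
      have := this (-y) hy
      simpa using this

theorem stable_eq {d : ℕ} (G : SimpleGraph (Fin d)) :
    stableSetPolytope G = complexPolytope {S : Finset (Fin d) | IsStableSet G (S : Set (Fin d))} := by
  unfold stableSetPolytope complexPolytope
  congr 1
  ext x
  constructor
  · rintro ⟨S, hS, rfl⟩
    obtain ⟨F, rfl⟩ := set_eq_coe S
    exact ⟨F, hS, rfl⟩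
  · rintro ⟨S, hS, rfl⟩
    exact ⟨S, hS, rfl⟩

theorem zero_interior {d : ℕ} (hd : 1 ≤ d) (P : PartialOrder (Fin d)) (Δ : Set (Finset (Fin d)))
    (hΔ : IsSimplicialComplex Δ) :
    0 ∈ interior (gammaPolytope (orderPolytope P) (complexPolytope Δ)) := by
  classical
  set Γ := gammaPolytope (orderPolytope P) (complexPolytope Δ) with hΓ
  have hconv : Convex ℝ Γ := convex_convexHull ℝ _
  have h1 : (fun _ => 1 : Fin d → ℝ) ∈ Γ := by
    apply subset_convexHull ℝ _
    left
    apply subset_convexHull ℝ _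
    exact ⟨Set.univ, fun _ _ _ _ => trivial, by ext; simp [indicator]⟩
  have h0 : (0 : Fin d → ℝ) ∈ Γ := by
    apply subset_convexHull ℝ _
    left
    apply subset_convexHull ℝ _
    exact ⟨∅, fun _ h => h.elim, by ext; simp [indicator]⟩
  have he : ∀ i, (-(Pi.single i 1) : Fin d → ℝ) ∈ Γ := by
    intro i
    apply subset_convexHull ℝ _
    right
    rw [Set.neg_mem_neg]
    apply subset_convexHull ℝ _
    refine ⟨{i}, hΔ.1 i, ?_⟩
    ext j
    simp [indicator, Set.indicator_apply, Pi.single_apply]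
  have hdpos : (0 : ℝ) < d := by exact_mod_cast hd
  set t : ℝ := 1 / (2 * d + 1) with ht
  have htpos : 0 < t := by positivity
  have htd : t * (2 * d + 1) = 1 := by rw [ht]; field_simp
  have hball : Metric.ball (0 : Fin d → ℝ) t ⊆ Γ := by
    intro y hy
    have hyt : ∀ i, |y i| < t := by
      intro i
      rw [mem_ball_zero_iff] at hy
      exact lt_of_le_of_lt (norm_le_pi_norm y i) hy
    have hmem : ∀ i, (t • (fun _ => 1 : Fin d → ℝ) + (d * (t - y i)) • (-(Pi.single i 1) : Fin d → ℝ)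
        + (1 - t - d * (t - y i)) • (0 : Fin d → ℝ)) ∈ Γ := by
      intro i
      have := abs_lt.1 (hyt i)
      have hb1 : 0 ≤ d * (t - y i) := mul_nonneg hdpos.le (by linarith)
      have hb2 : d * (t - y i) ≤ d * (2 * t) := mul_le_mul_of_nonneg_left (by linarith) hdpos.le
      have := hconv.sum_mem (t := Finset.univ) (w := ![t, d * (t - y i), 1 - t - d * (t - y i)])
        (z := ![(fun _ => 1 : Fin d → ℝ), (-(Pi.single i 1) : Fin d → ℝ), 0])
        (by intro k _; fin_cases k <;> simp <;> nlinarith)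
        (by simp [Fin.sum_univ_three])
        (by intro k _; fin_cases k <;> simp [h1, he, h0])
      simpa [Fin.sum_univ_three] using this
    have hsum := hconv.sum_mem (t := Finset.univ) (w := fun _ : Fin d => 1 / (d : ℝ)) (z := _)
      (fun _ _ => by positivity) (by simp; field_simp) (fun i _ => hmem i)
    convert hsum using 1
    ext j
    simp only [Finset.sum_apply, Pi.smul_apply, Pi.add_apply, Pi.neg_apply, smul_eq_mul, Pi.zero_apply,
      mul_zero, add_zero, mul_one, Pi.single_apply, mul_neg, mul_ite, mul_add, Finset.sum_add_distrib]
    simp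
    field_simp
    ring
  exact mem_interior.2 ⟨_, hball, Metric.isOpen_ball, Metric.mem_ball_self htpos⟩

theorem Dset_compact {d : ℕ} (A B : Set (Finset (Fin d))) (hA : Finset.univ ∈ A)
    (hB : ∀ i, {i} ∈ B) : IsCompact (Dset A B) := by
  classical
  have hclosed : IsClosed (Dset A B) := by
    have : Dset A B = (⋂ I ∈ A, {x : Fin d → ℝ | ∑ i ∈ I, x i ≤ 1}) ∩
        (⋂ S ∈ B, {x : Fin d → ℝ | -1 ≤ ∑ i ∈ S, x i}) := by
      ext x; simp [Dset]
    rw [this]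
    apply IsClosed.inter
    · exact isClosed_biInter fun I _ => isClosed_le (by fun_prop) (by fun_prop)
    · exact isClosed_biInter fun I _ => isClosed_le (by fun_prop) (by fun_prop)
  refine IsCompact.of_isClosed_subset (isCompact_univ_pi (fun _ : Fin d => isCompact_Icc (a := (-1 : ℝ)) (b := 1 + d))) hclosed ?_
  rintro x ⟨h1, h2⟩ i _
  have h3 : ∀ i, -1 ≤ x i := fun i => by simpa using h2 _ (hB i)
  refine ⟨h3 i, ?_⟩
  have h4 := h1 _ hA
  rw [← Finset.add_sum_erase _ _ (Finset.mem_univ i)] at h4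
  have h5 : ∑ j ∈ Finset.univ.erase i, (-1 : ℝ) ≤ ∑ j ∈ Finset.univ.erase i, x j :=
    Finset.sum_le_sum fun j _ => h3 j
  have h6 : ((Finset.univ.erase i).card : ℝ) ≤ d := by
    have := Finset.card_le_univ (Finset.univ.erase i)
    simp only [Fintype.card_fin] at this
    exact_mod_cast this
  simp only [Finset.sum_const, nsmul_eq_mul] at h5
  linarith

theorem Dset_convex {d : ℕ} (A B : Set (Finset (Fin d))) : Convex ℝ (Dset A B) := by
  rintro x ⟨h1, h2⟩ y ⟨h3, h4⟩ a b ha hb hab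
  have key : ∀ S : Finset (Fin d), ∑ i ∈ S, (a • x + b • y) i = a * ∑ i ∈ S, x i + b * ∑ i ∈ S, y i := by
    intro S
    simp [Finset.sum_add_distrib, Finset.mul_sum]
  refine ⟨fun I hI => ?_, fun S hS => ?_⟩
  · rw [key]; nlinarith [h1 I hI, h3 I hI]
  · rw [key]; nlinarith [h2 S hS, h4 S hS]

/-- If every extreme point is a lattice point, the polytope is a lattice polytope. -/
theorem Dset_lattice {d : ℕ} (A B : Set (Finset (Fin d))) (hA : Finset.univ ∈ A)
    (hB : ∀ i, {i} ∈ B) (hext : ∀ a ∈ (Dset A B).extremePoints ℝ, IsLatticePoint a) :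
    ∃ V : Finset (Fin d → ℝ), (∀ v ∈ V, IsLatticePoint v) ∧
      Dset A B = convexHull ℝ (V : Set (Fin d → ℝ)) := by
  classical
  have hcomp := Dset_compact A B hA hB
  have hfin : ((Dset A B).extremePoints ℝ).Finite := by
    obtain ⟨R, hR⟩ := hcomp.isBounded.exists_norm_le
    have hf : (Set.pi Set.univ (fun _ : Fin d => (fun z : ℤ => (z : ℝ)) '' Set.Icc (-⌈R⌉) ⌈R⌉)).Finite :=
      Set.Finite.pi fun _ => (Set.finite_Icc _ _).image _
    refine hf.subset ?_
    intro a ha i _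
    obtain ⟨z, hz⟩ := hext a ha i
    refine ⟨z, ?_, hz.symm⟩
    have h1 := (norm_le_pi_norm a i).trans (hR a ha.1)
    rw [hz, Real.norm_eq_abs, abs_le] at h1
    have h2 := Int.le_ceil R
    constructor
    · have : ((-⌈R⌉ : ℤ) : ℝ) ≤ z := by push_cast; linarith
      exact_mod_cast this
    · have : (z : ℝ) ≤ (⌈R⌉ : ℤ) := by linarith
      exact_mod_cast this
  refine ⟨hfin.toFinset, fun v hv => hext v (by simpa using hv), ?_⟩
  rw [Set.Finite.coe_toFinset]
  rw [← (hfin.isClosed_convexHull (𝕜 := ℝ)).closure_eq]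
  exact (closure_convexHull_extremePoints hcomp (Dset_convex A B)).symm

theorem extreme_zero {d : ℕ} (A B : Set (Finset (Fin d))) (a c : Fin d → ℝ)
    (ha : a ∈ (Dset A B).extremePoints ℝ)
    (hcA : ∀ I ∈ A, ∑ i ∈ I, a i = 1 → ∑ i ∈ I, c i = 0)
    (hcB : ∀ S ∈ B, ∑ i ∈ S, a i = -1 → ∑ i ∈ S, c i = 0) : c = 0 := by
  have key : ∀ (S : Finset (Fin d)) (e : ℝ), ∑ i ∈ S, (a + e • c) i = ∑ i ∈ S, a i + e * ∑ i ∈ S, c i := by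
    intro S e
    simp [Finset.sum_add_distrib, Finset.mul_sum]
  have hev : ∀ᶠ e : ℝ in nhds 0, a + e • c ∈ Dset A B := by
    have e1 : ∀ᶠ e : ℝ in nhds 0, ∀ I : Finset (Fin d), I ∈ A → ∑ i ∈ I, (a + e • c) i ≤ 1 := by
      rw [Filter.eventually_all]
      intro I
      by_cases hI : I ∈ A
      · by_cases ht : ∑ i ∈ I, a i = 1
        · refine Filter.Eventually.of_forall fun e _ => ?_
          rw [key, hcA I hI ht, ht]; simp
        · have hlt : ∑ i ∈ I, a i + 0 * ∑ i ∈ I, c i < 1 := by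
            have := lt_of_le_of_ne (ha.1.1 I hI) ht
            linarith
          have hcont : ContinuousAt (fun e : ℝ => ∑ i ∈ I, a i + e * ∑ i ∈ I, c i) 0 := by fun_prop
          filter_upwards [hcont.eventually_lt_const hlt] with e he _
          rw [key]; exact he.le
      · exact Filter.Eventually.of_forall fun e h => (hI h).elim
    have e2 : ∀ᶠ e : ℝ in nhds 0, ∀ I : Finset (Fin d), I ∈ B → -1 ≤ ∑ i ∈ I, (a + e • c) i := by
      rw [Filter.eventually_all]
      intro I
      by_cases hI : I ∈ B
      · by_cases ht : ∑ i ∈ I, a i = -1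
        · refine Filter.Eventually.of_forall fun e _ => ?_
          rw [key, hcB I hI ht, ht]; simp
        · have hlt : -1 < ∑ i ∈ I, a i + 0 * ∑ i ∈ I, c i := by
            have := lt_of_le_of_ne (ha.1.2 I hI) (Ne.symm ht)
            linarith
          have hcont : ContinuousAt (fun e : ℝ => ∑ i ∈ I, a i + e * ∑ i ∈ I, c i) 0 := by fun_prop
          filter_upwards [hcont.eventually_const_lt hlt] with e he _
          rw [key]; exact he.le
      · exact Filter.Eventually.of_forall fun e h => (hI h).elim
    filter_upwards [e1, e2] with e h1 h2
    exact ⟨h1, h2⟩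
  obtain ⟨r, hr, hball⟩ := Metric.eventually_nhds_iff.1 hev
  have m1 := hball (y := r / 2) (by simp [abs_of_pos hr, hr])
  have m2 := hball (y := -(r / 2)) (by simp [abs_of_pos hr, hr])
  have hseg : a ∈ openSegment ℝ (a + (r / 2) • c) (a + (-(r / 2)) • c) :=
    ⟨1 / 2, 1 / 2, by norm_num, by norm_num, by norm_num, by ext i; simp; ring⟩
  have heq := ha.2 m1 m2 hseg
  ext i
  have := congrFun heq i
  simp at this
  rcases this with h | h
  · linarith
  · exact h

open Finset in
/-- Partition into classes given by a lattice of tight sets. -/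
theorem tight_classes {d : ℕ} (T : Finset (Finset (Fin d))) (a : Fin d → ℝ)
    (hT : ∀ I ∈ T, ∑ i ∈ I, a i = 1) (hun : ∀ I ∈ T, ∀ J ∈ T, I ∪ J ∈ T)
    (hin : ∀ I ∈ T, ∀ J ∈ T, I ∩ J ∈ T) :
    ∃ M : Fin d → Finset (Fin d), (∀ I ∈ T, ∀ i ∈ I, ∀ j, M j = M i → j ∈ I) ∧
      ∀ I ∈ T, ∀ i ∈ I, ∑ j ∈ univ.filter (fun j => M j = M i), a j = 0 ∨
        ∑ j ∈ univ.filter (fun j => M j = M i), a j = 1 := by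
  classical
  let M : Fin d → Finset (Fin d) := fun i => univ.filter (fun j => ∀ I ∈ T, i ∈ I → j ∈ I)
  have hMself : ∀ i, i ∈ M i := fun i => by simp [M]
  have hMsub : ∀ i, ∀ I ∈ T, i ∈ I → M i ⊆ I := by
    intro i I hI hi j hj
    simp only [M, mem_filter, mem_univ, true_and] at hj
    exact hj I hI hi
  have hMT : ∀ I ∈ T, ∀ i ∈ I, M i ∈ T := by
    intro I hI i hi
    have hne : (T.filter (fun I => i ∈ I)).Nonempty := ⟨I, by simp [hI, hi]⟩
    have heq : M i = (T.filter (fun I => i ∈ I)).inf' hne id := by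
      ext j
      rw [Finset.mem_inf']
      simp [M]
    rw [heq]
    refine Finset.inf'_induction (p := fun J => J ∈ T) hne _ ?_ ?_
    · intro J hJ K hK; exact hin J hJ K hK
    · intro J hJ; exact (mem_filter.1 hJ).1
  refine ⟨M, ?_, ?_⟩
  · intro I hI i hi j hj
    have := hMsub i I hI hi
    rw [← hj] at this
    exact this (hMself j)
  · intro I hI i hi
    have hMi := hMT I hI i hi
    have hU : (T.filter (fun J => J ⊂ M i)).sup id = ∅ ∨ (T.filter (fun J => J ⊂ M i)).sup id ∈ T := by
      rcases (T.filter (fun J => J ⊂ M i)).eq_empty_or_nonempty with h | h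
      · left; rw [h]; rfl
      · right
        rw [← Finset.sup'_eq_sup h]
        refine Finset.sup'_induction (p := fun J => J ∈ T) h _ ?_ ?_
        · intro J hJ K hK; exact hun J hJ K hK
        · intro J hJ; exact (mem_filter.1 hJ).1
    set U := (T.filter (fun J => J ⊂ M i)).sup id with hUdef
    have hmemU : ∀ j, j ∈ U ↔ ∃ J ∈ T, J ⊂ M i ∧ j ∈ J := by
      intro j
      rw [hUdef, Finset.mem_sup]
      simp [and_assoc]
    have hUM : U ⊆ M i := by
      intro j hj
      obtain ⟨J, _, h2, h3⟩ := (hmemU j).1 hj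
      exact h2.1 h3
    have hC : univ.filter (fun j => M j = M i) = M i \ U := by
      ext j
      simp only [mem_filter, mem_univ, true_and, mem_sdiff]
      constructor
      · intro hj
        refine ⟨hj ▸ hMself j, fun hjU => ?_⟩
        obtain ⟨J, h1, h2, h3⟩ := (hmemU j).1 hjU
        have := hMsub j J h1 h3
        rw [hj] at this
        exact h2.2 this
      · rintro ⟨h1, h2⟩
        by_contra hne
        apply h2
        have hs := hMsub j _ hMi h1
        exact (hmemU j).2 ⟨M j, hMT _ hMi j h1, lt_of_le_of_ne hs hne, hMself j⟩
    rw [hC]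
    have hsum := Finset.sum_sdiff (f := a) hUM
    rw [hT _ hMi] at hsum
    rcases hU with h | h
    · right
      rw [h] at hsum ⊢
      simpa using hsum
    · left
      rw [hT _ h] at hsum
      linarith

theorem weights_tight {d : ℕ} (y : Finset (Fin d) → ℝ) (hy : ∀ F, 0 ≤ y F) (hs : ∑ F, y F = 1)
    (n : Finset (Fin d) → ℝ) (hn : ∀ F, y F ≠ 0 → n F ≤ 1) (h1 : ∑ F, y F * n F = 1) :
    ∀ F, y F ≠ 0 → n F = 1 := by
  have hz : ∑ F, y F * (1 - n F) = 0 := by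
    simp only [mul_sub, mul_one, Finset.sum_sub_distrib]
    linarith
  intro F hF
  have := (Finset.sum_eq_zero_iff_of_nonneg (fun F _ => by
    by_cases h : y F = 0
    · simp [h]
    · exact mul_nonneg (hy F) (by linarith [hn F h]))).1 hz F (Finset.mem_univ F)
  rcases mul_eq_zero.1 this with h | h
  · exact (hF h).elim
  · linarith

theorem sum_decomp {d : ℕ} (y : Finset (Fin d) → ℝ) (x : Fin d → ℝ)
    (hx : ∀ i, x i = ∑ F, if i ∈ F then y F else 0) (S : Finset (Fin d)) :
    ∑ i ∈ S, x i = ∑ F, y F * ((S ∩ F).card : ℝ) := by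
  simp_rw [hx]
  rw [Finset.sum_comm]
  refine Finset.sum_congr rfl fun F _ => ?_
  rw [← Finset.sum_filter, Finset.filter_mem_eq_inter]
  simp [mul_comm]

theorem clique_stable {d : ℕ} (G : SimpleGraph (Fin d)) (S K : Finset (Fin d))
    (hS : IsStableSet G (S : Set (Fin d))) (hK : G.IsClique (K : Set (Fin d))) :
    (S ∩ K).card ≤ 1 := by
  rw [Finset.card_le_one]
  intro a ha b hb
  by_contra hab
  simp only [Finset.mem_inter] at ha hb
  exact hS a ha.1 b hb.1 (hK ha.2 hb.2 hab)

open Finset in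
theorem core_integral {d : ℕ} (A : Set (Finset (Fin d))) (G : SimpleGraph (Fin d))
    (hG : IsPerfectGraph G) (hun : ∀ I ∈ A, ∀ J ∈ A, I ∪ J ∈ A)
    (hin : ∀ I ∈ A, ∀ J ∈ A, I ∩ J ∈ A) (a : Fin d → ℝ)
    (ha : a ∈ (Dset A {S | IsStableSet G (S : Set (Fin d))}).extremePoints ℝ) :
    IsLatticePoint a := by
  classical
  have haD := ha.1
  set B : Set (Finset (Fin d)) := {S | IsStableSet G (S : Set (Fin d))} with hB
  have hBsub : ∀ S ∈ B, ∀ S' ⊆ S, S' ∈ B := fun S hS S' h i hi j hj => hS i (h hi) j (h hj)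
  -- tight sets
  set T : Finset (Finset (Fin d)) := univ.filter (fun I => I ∈ A ∧ ∑ i ∈ I, a i = 1) with hTdef
  have hTmem : ∀ I, I ∈ T ↔ I ∈ A ∧ ∑ i ∈ I, a i = 1 := fun I => by simp [hTdef]
  have hT2 : ∀ I ∈ T, ∀ J ∈ T, I ∪ J ∈ T ∧ I ∩ J ∈ T := by
    intro I hI J hJ
    rw [hTmem] at hI hJ
    have h1 := haD.1 _ (hun I hI.1 J hJ.1)
    have h2 := haD.1 _ (hin I hI.1 J hJ.1)
    have h3 := Finset.sum_union_inter (s₁ := I) (s₂ := J) (f := a)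
    rw [hTmem, hTmem]
    exact ⟨⟨hun I hI.1 J hJ.1, by linarith [hI.2, hJ.2]⟩, hin I hI.1 J hJ.1, by linarith [hI.2, hJ.2]⟩
  obtain ⟨M, hM1, hM2⟩ := tight_classes T a (fun I hI => ((hTmem I).1 hI).2)
    (fun I hI J hJ => (hT2 I hI J hJ).1) (fun I hI J hJ => (hT2 I hI J hJ).2)
  -- decomposition of the negative part
  set w : Fin d → ℝ := fun i => max (-a i) 0 with hw
  have hwS : ∀ S ∈ B, ∑ i ∈ S, w i ≤ 1 := by
    intro S hS
    have h1 := haD.2 (S.filter (fun i => a i < 0)) (hBsub S hS _ (filter_subset _ _))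
    rw [Finset.sum_filter] at h1
    have h2 : ∑ i ∈ S, w i = - ∑ i ∈ S, (if a i < 0 then a i else 0) := by
      rw [← Finset.sum_neg_distrib]
      refine Finset.sum_congr rfl fun i _ => ?_
      simp only [hw]
      split_ifs with h
      · exact max_eq_left (by linarith)
      · rw [neg_zero]; exact max_eq_right (by linarith)
    linarith
  obtain ⟨y, hy0, hysum, hyK, hyw⟩ := complex_decomp _ w
    (perfect_decomp G hG w (fun i => le_max_right _ _) hwS)
  have hKneg : ∀ K, y K ≠ 0 → ∀ i ∈ K, a i < 0 := by
    intro K hK i hi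
    have h1 : y K ≤ w i := by
      rw [hyw]
      refine le_trans (le_of_eq ?_) (Finset.single_le_sum (fun F _ => ?_) (mem_univ K))
      · simp [hi]
      · split_ifs
        · exact hy0 F
        · exact le_rfl
    have h2 : 0 < w i := lt_of_lt_of_le (lt_of_le_of_ne (hy0 K) (Ne.symm hK)) h1
    simp only [hw, lt_max_iff, lt_irrefl, or_false] at h2
    linarith
  have hSneg : ∀ S ∈ B, ∑ i ∈ S, a i = -1 → ∀ i ∈ S, a i ≤ 0 := by
    intro S hS hSt i hi
    have h1 := haD.2 (S.erase i) (hBsub S hS _ (erase_subset _ _))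
    rw [← Finset.add_sum_erase _ _ hi] at hSt
    linarith
  have hSK : ∀ S ∈ B, ∑ i ∈ S, a i = -1 → ∀ K, y K ≠ 0 → ((S ∩ K).card : ℝ) = 1 := by
    intro S hS hSt
    apply weights_tight y hy0 hysum (fun K => ((S ∩ K).card : ℝ))
    · intro K hK
      exact_mod_cast clique_stable G S K hS (hyK K hK)
    · rw [← sum_decomp y w hyw S]
      have : ∑ i ∈ S, w i = ∑ i ∈ S, (-a i) := Finset.sum_congr rfl fun i hi =>
        max_eq_left (by linarith [hSneg S hS hSt i hi])
      rw [this, Finset.sum_neg_distrib, hSt]; norm_num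
  have hclass : ∀ c : Fin d → ℝ,
      (∀ I ∈ T, ∀ i ∈ I, ∑ j ∈ univ.filter (fun j => M j = M i), c j = 0) →
      ∀ I ∈ T, ∑ i ∈ I, c i = 0 := by
    intro c hc I hI
    rw [← Finset.sum_fiberwise_of_maps_to (t := I.image M) (g := M) (fun i hi => mem_image_of_mem M hi)]
    apply Finset.sum_eq_zero
    intro m hm
    obtain ⟨i, hi, rfl⟩ := mem_image.1 hm
    rw [← hc I hI i hi]
    refine Finset.sum_congr ?_ fun _ _ => rfl
    ext j
    simp only [mem_filter, mem_univ, true_and, and_iff_right_iff_imp]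
    exact hM1 I hI i hi j
  -- there is at most one clique in the support
  have huniq : ∀ K1 K2, y K1 ≠ 0 → y K2 ≠ 0 → K1 = K2 := by
    intro K1 K2 hK1 hK2
    set g : Fin d → ℝ := fun i => (if i ∈ K2 then 1 else 0) - (if i ∈ K1 then 1 else 0) with hg
    have hg0 : ∀ i, 0 ≤ a i → g i = 0 := by
      intro i hi
      have h1 : i ∉ K1 := fun h => by linarith [hKneg K1 hK1 i h]
      have h2 : i ∉ K2 := fun h => by linarith [hKneg K2 hK2 i h]
      simp [hg, h1, h2]
    have hr : ∀ m : Finset (Fin d), ∃ r : Option (Fin d),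
        (∀ i, r = some i → M i = m ∧ 0 < a i) ∧ (r = none → ∀ i, M i = m → a i ≤ 0) := by
      intro m
      by_cases h : ∃ i, M i = m ∧ 0 < a i
      · obtain ⟨i, hi⟩ := h
        refine ⟨some i, ?_, by simp⟩
        intro j hj
        obtain rfl := Option.some.inj hj
        exact hi
      · push Not at h
        exact ⟨none, by simp, fun _ i hi => h i hi⟩
    choose r hr1 hr2 using hr
    set c : Fin d → ℝ := fun i => g i - (if r (M i) = some i then
      ∑ j ∈ univ.filter (fun j => M j = M i), g j else 0) with hc
    have hcneg : ∀ i, a i ≤ 0 → c i = g i := by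
      intro i hi
      have : r (M i) ≠ some i := fun h => by linarith [(hr1 _ _ h).2]
      simp [hc, this]
    have hc0 : c = 0 := by
      refine extreme_zero A B a c ha ?_ ?_
      · intro I hI hIt
        refine hclass c ?_ I ((hTmem I).2 ⟨hI, hIt⟩)
        intro I hI i hi
        cases hrm : r (M i) with
        | none =>
          have hle := hr2 _ hrm
          have hz : ∀ j ∈ univ.filter (fun j => M j = M i), a j = 0 := by
            have h0 : 0 ≤ ∑ j ∈ univ.filter (fun j => M j = M i), a j := by
              rcases hM2 I hI i hi with h | h <;> rw [h]; norm_num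
            have h1 : ∑ j ∈ univ.filter (fun j => M j = M i), a j = 0 :=
              le_antisymm (Finset.sum_nonpos fun j hj => hle j (mem_filter.1 hj).2) h0
            exact (Finset.sum_eq_zero_iff_of_nonpos fun j hj => hle j (mem_filter.1 hj).2).1 h1
          apply Finset.sum_eq_zero
          intro j hj
          rw [hcneg j (hz j hj).le, hg0 j (hz j hj).ge]
        | some k =>
          have hk := hr1 _ _ hrm
          simp only [hc]
          rw [Finset.sum_sub_distrib]
          rw [Finset.sum_eq_single_of_mem (s := univ.filter (fun j => M j = M i))
            (f := fun i => if r (M i) = some i then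
              ∑ j ∈ univ.filter (fun j => M j = M i), g j else 0) k (by simp [hk.1])]
          · simp [hk.1, hrm]
          · intro j hj hjk
            rw [(mem_filter.1 hj).2, hrm, if_neg]
            intro h; exact hjk (Option.some.inj h).symm
      · intro S hS hSt
        rw [Finset.sum_congr rfl fun i hi => hcneg i (hSneg S hS hSt i hi)]
        have h1 := hSK S hS hSt K1 hK1
        have h2 := hSK S hS hSt K2 hK2
        simp only [hg, Finset.sum_sub_distrib, Finset.sum_ite_mem, Finset.sum_const, nsmul_eq_mul, mul_one]
        rw [h1, h2]; norm_num
    ext i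
    by_cases hi : a i ≤ 0
    · have h1 := hcneg i hi
      rw [hc0] at h1
      simp only [hg, Pi.zero_apply] at h1
      by_cases h2 : i ∈ K1 <;> by_cases h3 : i ∈ K2 <;> simp [h2, h3] at h1 ⊢
    · exact ⟨fun h => (hi (hKneg K1 hK1 i h).le).elim, fun h => (hi (hKneg K2 hK2 i h).le).elim⟩
  obtain ⟨K, hK⟩ : ∃ K, y K ≠ 0 := by
    by_contra h
    push Not at h
    simp [h] at hysum
  have hyz : ∀ F, F ≠ K → y F = 0 := fun F hF => by
    by_contra h
    exact hF (huniq F K h hK)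
  have hyK1 : y K = 1 := by
    rw [← hysum, Finset.sum_eq_single K (fun F _ hF => hyz F hF) (by simp)]
  have hwK : ∀ i, w i = if i ∈ K then 1 else 0 := by
    intro i
    rw [hyw, Finset.sum_eq_single K (fun F _ hF => by simp [hyz F hF]) (by simp), hyK1]
  have hint : ∀ i, a i ≤ 0 → ∃ z : ℤ, a i = z := by
    intro i hi
    have h1 := hwK i
    simp only [hw] at h1
    rw [max_eq_left (by linarith)] at h1
    split_ifs at h1
    · exact ⟨-1, by push_cast; linarith⟩
    · exact ⟨0, by push_cast; linarith⟩
  intro i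
  by_cases hi : a i ≤ 0
  · exact hint i hi
  push Not at hi
  by_cases hcovd : ∃ I ∈ T, i ∈ I
  · obtain ⟨I0, hI0, hiI0⟩ := hcovd
    have hothers : ∀ j, j ≠ i → M j = M i → a j ≤ 0 := by
      intro j hji hMj
      by_contra hj
      push Not at hj
      have hc0 := extreme_zero A B a (fun k => (if k = i then 1 else 0) - (if k = j then 1 else 0)) ha
        (by
          intro I hI hIt
          have hIT := (hTmem I).2 ⟨hI, hIt⟩
          have : i ∈ I ↔ j ∈ I := ⟨fun h => hM1 I hIT i h j hMj, fun h => hM1 I hIT j h i hMj.symm⟩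
          simp [Finset.sum_sub_distrib, this])
        (by
          intro S hS hSt
          have h1 : i ∉ S := fun h => by linarith [hSneg S hS hSt i h]
          have h2 : j ∉ S := fun h => by linarith [hSneg S hS hSt j h]
          simp [Finset.sum_sub_distrib, h1, h2])
      have := congrFun hc0 i
      simp [Ne.symm hji] at this
    have hsumint : ∃ z : ℤ, ∑ j ∈ (univ.filter (fun j => M j = M i)).erase i, a j = z := by
      have : ∀ j ∈ (univ.filter (fun j => M j = M i)).erase i, ∃ z : ℤ, a j = z := by
        intro j hj
        simp only [mem_erase, mem_filter, mem_univ, true_and] at hj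
        exact hint j (hothers j hj.1 hj.2)
      choose! f hf using this
      refine ⟨∑ j ∈ (univ.filter (fun j => M j = M i)).erase i, f j, ?_⟩
      push_cast
      exact Finset.sum_congr rfl hf
    obtain ⟨z, hz⟩ := hsumint
    have h1 := Finset.add_sum_erase (univ.filter (fun j => M j = M i)) a (a := i) (by simp)
    rcases hM2 I0 hI0 i hiI0 with h | h
    · exact ⟨-z, by push_cast; linarith⟩
    · exact ⟨1 - z, by push_cast; linarith⟩
  · exfalso
    push Not at hcovd
    have hc0 := extreme_zero A B a (fun k => if k = i then 1 else 0) ha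
      (by
        intro I hI hIt
        have := hcovd I ((hTmem I).2 ⟨hI, hIt⟩)
        simp [this])
      (by
        intro S hS hSt
        have h1 : i ∉ S := fun h => by linarith [hSneg S hS hSt i h]
        simp [h1])
    have := congrFun hc0 i
    simp at this

theorem perfect_reflexive {d : ℕ} (hd : 1 ≤ d) (G : SimpleGraph (Fin d)) (hG : IsPerfectGraph G)
    (P : PartialOrder (Fin d)) :
    IsReflexive (gammaPolytope (orderPolytope P) (stableSetPolytope G)) := by
  classical
  have hsing : ∀ i : Fin d, ({i} : Finset (Fin d)) ∈
      {S : Finset (Fin d) | IsStableSet G (S : Set (Fin d))} := by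
    intro i a ha b hb hab
    simp only [Finset.coe_singleton, Set.mem_singleton_iff] at ha hb
    subst ha; subst hb
    exact G.loopless.irrefl _ hab
  rw [stable_eq]
  refine ⟨zero_interior hd P _ ⟨hsing, fun F hF F' h i hi j hj => hF i (h hi) j (h hj)⟩, ?_⟩
  rw [dual_gamma]
  refine Dset_lattice _ _ ?_ hsing ?_
  · intro i _ j _; simp
  · intro a ha
    refine core_integral _ G hG ?_ ?_ a ha
    · intro I hI J hJ i hi j hj
      simp only [Finset.coe_union, Set.mem_union] at hi ⊢
      exact hi.imp (fun h => hI i h j hj) (fun h => hJ i h j hj)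
    · intro I hI J hJ i hi j hj
      simp only [Finset.coe_inter, Set.mem_inter_iff] at hi ⊢
      exact ⟨hI i hi.1 j hj, hJ i hi.2 j hj⟩

/-- The graph of non-edges of a complex. -/
def nonEdgeGraph {d : ℕ} (Δ : Set (Finset (Fin d))) : SimpleGraph (Fin d) where
  Adj i j := i ≠ j ∧ ({i, j} : Finset (Fin d)) ∉ Δ
  symm := ⟨fun i j h => ⟨h.1.symm, by rw [Finset.pair_comm]; exact h.2⟩⟩
  loopless := ⟨fun _ h => h.1 rfl⟩

theorem antiblock {d : ℕ} (A Δ : Set (Finset (Fin d))) (hΔ : IsSimplicialComplex Δ)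
    (V : Finset (Fin d → ℝ)) (hV : ∀ v ∈ V, IsLatticePoint v)
    (hD : Dset A Δ = convexHull ℝ (V : Set (Fin d → ℝ)))
    (x z : Fin d → ℝ) (hx : ∀ i, 0 ≤ x i) (hz : ∀ i, 0 ≤ z i)
    (hzF : ∀ F ∈ Δ, ∑ i ∈ F, z i ≤ 1)
    (hxK : ∀ K : Finset (Fin d), (nonEdgeGraph Δ).IsClique (K : Set (Fin d)) → ∑ i ∈ K, x i ≤ 1) :
    ∑ i, x i * z i ≤ 1 := by
  classical
  have hzD : -z ∈ Dset A Δ := by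
    constructor
    · intro I _
      have : 0 ≤ ∑ i ∈ I, z i := Finset.sum_nonneg fun i _ => hz i
      simp only [Pi.neg_apply, Finset.sum_neg_distrib]
      linarith
    · intro F hF
      have := hzF F hF
      simp only [Pi.neg_apply, Finset.sum_neg_distrib]
      linarith
  have hdual : -x ∈ dualPolytope (convexHull ℝ (V : Set (Fin d → ℝ))) := by
    rw [dual_hull]
    intro v hv
    have hvD : v ∈ Dset A Δ := by rw [hD]; exact subset_convexHull ℝ _ hv
    have hneg : ∀ i, v i < 0 → v i = -1 := by
      intro i hi
      obtain ⟨t, ht⟩ := hV v hv i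
      have h1 := hvD.2 _ (hΔ.1 i)
      rw [Finset.sum_singleton] at h1
      rw [ht] at h1 hi ⊢
      have h2 : -1 ≤ t := by exact_mod_cast h1
      have h3 : t < 0 := by exact_mod_cast hi
      have : t = -1 := by omega
      rw [this]; norm_num
    have hcl := hxK (Finset.univ.filter (fun i => v i < 0)) (by
      intro i hi j hj hij
      simp only [Finset.coe_filter, Finset.mem_univ, true_and, Set.mem_ofPred_eq] at hi hj
      refine ⟨hij, fun hmem => ?_⟩
      have := hvD.2 _ hmem
      rw [Finset.sum_pair hij, hneg i hi, hneg j hj] at this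
      linarith)
    refine le_trans ?_ hcl
    rw [Finset.sum_filter]
    refine Finset.sum_le_sum fun i _ => ?_
    split_ifs with h
    · rw [hneg i h]; simp
    · have := mul_nonneg (hx i) (not_lt.1 h)
      simp only [Pi.neg_apply]
      linarith
  have := hdual (-z) (hD ▸ hzD)
  simpa using this

theorem mem_complex {d : ℕ} (hd : 1 ≤ d) (A Δ : Set (Finset (Fin d))) (hΔ : IsSimplicialComplex Δ)
    (V : Finset (Fin d → ℝ)) (hV : ∀ v ∈ V, IsLatticePoint v)
    (hD : Dset A Δ = convexHull ℝ (V : Set (Fin d → ℝ)))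
    (x : Fin d → ℝ) (hx : ∀ i, 0 ≤ x i)
    (hxK : ∀ K : Finset (Fin d), (nonEdgeGraph Δ).IsClique (K : Set (Fin d)) → ∑ i ∈ K, x i ≤ 1) :
    x ∈ complexPolytope Δ := by
  classical
  by_contra hcon
  obtain ⟨z, u, h1, h2⟩ := separation _ (convex_convexHull ℝ _) (complex_closed _) x hcon
  have hF : ∀ F ∈ Δ, ∑ i ∈ F, z i < u := by
    intro F hF
    have := h1 _ (complex_mem Δ F hF)
    rwa [sum_mul_indicator] at this
  have hu : 0 < u := by
    simpa using hF ∅ (hΔ.2 _ (hΔ.1 ⟨0, hd⟩) ∅ (Finset.empty_subset _))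
  have hF' : ∀ F ∈ Δ, ∑ i ∈ F, max (z i) 0 / u ≤ 1 := by
    intro F hFm
    have h3 := hF _ (hΔ.2 F hFm (F.filter (fun i => 0 < z i)) (Finset.filter_subset _ _))
    rw [Finset.sum_filter] at h3
    rw [← Finset.sum_div, div_le_one hu]
    refine le_trans (le_of_eq (Finset.sum_congr rfl fun i _ => ?_)) h3.le
    split_ifs with h
    · exact max_eq_left h.le
    · exact max_eq_right (not_lt.1 h)
  have h4 := antiblock A Δ hΔ V hV hD x (fun i => max (z i) 0 / u) hx (fun i => by positivity) hF' hxK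
  have h5 : ∑ i, x i * (max (z i) 0 / u) = (∑ i, max (z i) 0 * x i) / u := by
    rw [Finset.sum_div]; exact Finset.sum_congr rfl fun i _ => by ring
  rw [h5, div_le_one hu] at h4
  have h6 : ∑ i, z i * x i ≤ ∑ i, max (z i) 0 * x i :=
    Finset.sum_le_sum fun i _ => mul_le_mul_of_nonneg_right (le_max_left _ _) (hx i)
  linarith

theorem complex_colour {d : ℕ} (Δ : Set (Finset (Fin d))) (hΔ : IsSimplicialComplex Δ)
    (hmem : ∀ x : Fin d → ℝ, (∀ i, 0 ≤ x i) →
      (∀ K : Finset (Fin d), (nonEdgeGraph Δ).IsClique (K : Set (Fin d)) → ∑ i ∈ K, x i ≤ 1) →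
      x ∈ complexPolytope Δ) :
    ∀ (N : ℕ) (H : Finset (Fin d)),
      (∀ K ⊆ H, (nonEdgeGraph Δ).IsClique (K : Set (Fin d)) → K.card ≤ N) →
      ∃ f : Fin d → ℕ, ∀ i ∈ H, f i < N ∧ ∀ j ∈ H, (nonEdgeGraph Δ).Adj i j → f i ≠ f j := by
  classical
  intro N
  induction N with
  | zero =>
    intro H hH
    refine ⟨fun _ => 0, fun i hi => ?_⟩
    have := hH {i} (by simpa using hi) (by simp)
    simp at this
  | succ N ih =>
    intro H hH
    have hpos : (0 : ℝ) < N + 1 := by positivity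
    have hsum : ∀ K : Finset (Fin d), ∑ i ∈ K, (if i ∈ H then 1 / ((N : ℝ) + 1) else 0)
        = ((K ∩ H).card : ℝ) / (N + 1) := by
      intro K
      rw [Finset.sum_ite_mem]
      simp [div_eq_mul_inv]
    have hx := hmem (fun i => if i ∈ H then 1 / ((N : ℝ) + 1) else 0)
      (fun i => by split_ifs <;> positivity) (by
        intro K hK
        rw [hsum, div_le_one hpos]
        exact_mod_cast hH _ Finset.inter_subset_right
          (hK.subset (Finset.coe_subset.2 Finset.inter_subset_left)))
    obtain ⟨y, hy0, hysum, hyΔ, hyx⟩ := complex_decomp _ _ hx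
    have hFK : ∀ F ∈ Δ, ∀ K : Finset (Fin d), (nonEdgeGraph Δ).IsClique (K : Set (Fin d)) →
        (K ∩ F).card ≤ 1 := by
      intro F hF K hK
      rw [Finset.card_le_one]
      intro i hi j hj
      by_contra hij
      simp only [Finset.mem_inter] at hi hj
      refine (hK hi.1 hj.1 hij).2 (hΔ.2 F hF _ ?_)
      intro k hk
      simp only [Finset.mem_insert, Finset.mem_singleton] at hk
      rcases hk with rfl | rfl
      · exact hi.2
      · exact hj.2
    obtain ⟨F, hF⟩ : ∃ F, y F ≠ 0 := by
      by_contra h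
      push Not at h
      simp [h] at hysum
    obtain ⟨f, hf⟩ := ih (H \ F) (by
      intro K hKH hK
      have hKH' : K ⊆ H := hKH.trans Finset.sdiff_subset
      by_contra hlt
      have hcard : K.card = N + 1 := le_antisymm (hH K hKH' hK) (by omega)
      have h1 := weights_tight y hy0 hysum (fun F => ((K ∩ F).card : ℝ))
        (fun F hF => by exact_mod_cast hFK F (hyΔ F hF) K hK)
        (by
          rw [← sum_decomp y _ hyx K, hsum, Finset.inter_eq_left.2 hKH', hcard]
          push_cast
          field_simp) F hF
      have h2 : (K ∩ F).card = 1 := by exact_mod_cast h1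
      obtain ⟨k, hk⟩ := Finset.card_pos.1 (by omega : 0 < (K ∩ F).card)
      rw [Finset.mem_inter] at hk
      exact (Finset.mem_sdiff.1 (hKH hk.1)).2 hk.2)
    refine ⟨fun i => if i ∈ F then N else f i, fun i hi => ⟨?_, ?_⟩⟩
    · by_cases h : i ∈ F
      · simp [h]
      · have := (hf i (by simp [hi, h])).1
        simp only [h, if_false]
        omega
    · intro j hj hadj
      by_cases h : i ∈ F <;> by_cases h' : j ∈ F
      · exfalso
        refine hadj.2 (hΔ.2 F (hyΔ F hF) _ ?_)
        intro k hk
        simp only [Finset.mem_insert, Finset.mem_singleton] at hk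
        rcases hk with rfl | rfl
        · exact h
        · exact h'
      · have := (hf j (by simp [hj, h'])).1
        simp only [h, h', if_true, if_false]
        omega
      · have := (hf i (by simp [hi, h])).1
        simp only [h, h', if_true, if_false]
        omega
      · simp only [h, h', if_false]
        exact (hf i (by simp [hi, h])).2 j (by simp [hj, h']) hadj

theorem reflexive_perfect {d : ℕ} (hd : 1 ≤ d) (Δ : Set (Finset (Fin d)))
    (hΔ : IsSimplicialComplex Δ) (P : PartialOrder (Fin d))
    (hR : IsReflexive (gammaPolytope (orderPolytope P) (complexPolytope Δ))) :
    ∃ G : SimpleGraph (Fin d), IsPerfectGraph G ∧ complexPolytope Δ = stableSetPolytope G := by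
  classical
  obtain ⟨_, V, hV, hD⟩ := hR
  rw [dual_gamma] at hD
  have hmem := mem_complex hd _ Δ hΔ V hV hD
  refine ⟨nonEdgeGraph Δ, ?_, ?_⟩
  · intro s
    apply le_antisymm
    · cases hN : cliqueNumber ((nonEdgeGraph Δ).induce s) with
      | top => exact le_top
      | coe N =>
        rw [SimpleGraph.chromaticNumber_le_iff_colorable]
        obtain ⟨f, hf⟩ := complex_colour Δ hΔ hmem N (Finset.univ.filter (· ∈ s)) (by
          intro K hK hKc
          have h1 : ((K.subtype (· ∈ s)).card : ℕ∞) ≤ N := by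
            rw [← hN]
            unfold cliqueNumber
            refine le_iSup₂_of_le (K.subtype (· ∈ s)) ?_ le_rfl
            intro i hi j hj hij
            simp only [Finset.mem_coe, Finset.mem_subtype] at hi hj
            exact hKc hi hj (fun h => hij (Subtype.ext h))
          rw [Finset.card_subtype, Finset.filter_true_of_mem (fun i hi => by simpa using hK hi)] at h1
          exact_mod_cast h1)
        refine ⟨SimpleGraph.Coloring.mk (fun i : s => (⟨f i.1, (hf i.1 (by simp)).1⟩ : Fin N)) ?_⟩
        intro i j hij h
        exact (hf i.1 (by simp)).2 j.1 (by simp) hij (congrArg Fin.val h)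
    · exact iSup₂_le fun t ht => ht.card_le_chromaticNumber
  · rw [stable_eq]
    congr 1
    ext F
    constructor
    · intro hF i hi j hj hadj
      refine hadj.2 (hΔ.2 F hF _ ?_)
      intro k hk
      simp only [Finset.mem_insert, Finset.mem_singleton] at hk
      rcases hk with rfl | rfl
      · exact hi
      · exact hj
    · intro hF
      have hx := hmem (fun i => if i ∈ F then 1 else 0)
        (fun i => by split_ifs <;> norm_num) (by
          intro K hK
          rw [Finset.sum_ite_mem]
          have := clique_stable _ F K hF hK
          rw [Finset.inter_comm] at this
          simpa using this)
      obtain ⟨y, hy0, hysum, hyΔ, hyx⟩ := complex_decomp _ _ hx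
      obtain ⟨F', hF'⟩ : ∃ F, y F ≠ 0 := by
        by_contra h
        push Not at h
        simp [h] at hysum
      refine hΔ.2 F' (hyΔ F' hF') F ?_
      intro i hi
      have h1 := weights_tight y hy0 hysum (fun F => if i ∈ F then 1 else 0)
        (fun F _ => by split_ifs <;> norm_num)
        (by
          have := hyx i
          simp only [hi, if_true] at this
          simpa using this.symm) F' hF'
      by_contra hcon
      simp [hcon] at h1

/-- **Proposition (Type Γ).** For a simplicial complex `Δ` on `[d]` (`d ≥ 1`),
the following are equivalent: (i) `Γ(O_P, P_Δ)` is reflexive for some poset `P` on `[d]`;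
(ii) `Γ(O_P, P_Δ)` is reflexive for all posets `P` on `[d]`;
(iii) there is a perfect graph `G` on `[d]` with `P_Δ = Q_G`. -/
theorem gamma_characterization (d : ℕ) (hd : 1 ≤ d) (Δ : Set (Finset (Fin d)))
    (hΔ : IsSimplicialComplex Δ) :
    List.TFAE
      [ (∃ P : PartialOrder (Fin d),
          IsReflexive (gammaPolytope (orderPolytope P) (complexPolytope Δ))),
        (∀ P : PartialOrder (Fin d),
          IsReflexive (gammaPolytope (orderPolytope P) (complexPolytope Δ))),
        (∃ G : SimpleGraph (Fin d),
          IsPerfectGraph G ∧ complexPolytope Δ = stableSetPolytope G) ] := by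
  tfae_have 1 → 3 := by
    rintro ⟨P, hP⟩
    exact reflexive_perfect hd Δ hΔ P hP
  tfae_have 3 → 2 := by
    rintro ⟨G, hG, hEq⟩ P
    rw [hEq]
    exact perfect_reflexive hd G hG P
  tfae_have 2 → 1 := fun h => ⟨inferInstance, h _⟩
  tfae_finish

end HibiTsuchiya
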